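/- Let F ⊆ ℕ → ℕ be unbounded with respect to ≤* and suppose that every subfamily F₀ ⊆ F of cardinality strictly less than the cardinality of F is bounded. Then the van Douwen space X_F is a first countable space of the same cardinality as F that is not metrizable, while every subspace Y ⊆ X_F of cardinality strictly less than the cardinality of F is metrizable. -/

import Mathlib

/-- The underlying type of the van Douwen space `X_F`:
the disjoint union `F ⊔ ℕ ⊔ (F × ℕ × ℕ)`. -/
def VDSpace (F : Set (ℕ → ℕ)) : Type := (↥F ⊕ ℕ) ⊕ (↥F × ℕ × ℕ)

namespace VDSpace

variable {F : Set (ℕ → ℕ)}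

/-- The (isolated) points of `X_F` coming from `F × ℕ × ℕ`. -/
def pt (p : ↥F × ℕ × ℕ) : VDSpace F := Sum.inr p

/-- The points of `X_F` coming from functions in `F`. -/
def fn (f : ↥F) : VDSpace F := Sum.inl (Sum.inl f)

/-- The points of `X_F` coming from natural numbers. -/
def nat (k : ℕ) : VDSpace F := Sum.inl (Sum.inr k)

/-- The basic neighborhood `O_{f,s} = {f} ∪ {(f, m, n) : f m = n, (m, n) ∉ s}` of `fn f`. -/
def basicO (f : ↥F) (s : Finset (ℕ × ℕ)) : Set (VDSpace F) :=
  {fn f} ∪ {x | ∃ m n : ℕ, (f : ℕ → ℕ) m = n ∧ (m, n) ∉ s ∧ x = pt (f, m, n)}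

/-- The basic neighborhood `U_{k,n} = {k} ∪ {(g, k, l) : g ∈ F, l ≥ n}` of `nat k`. -/
def basicU (k n : ℕ) : Set (VDSpace F) :=
  {nat k} ∪ {x | ∃ (g : ↥F) (l : ℕ), n ≤ l ∧ x = pt (g, k, l)}

/-- The topology of the van Douwen space: every point of `F × ℕ × ℕ` is isolated,
the sets `O_{f,s}` form a neighborhood basis of `f ∈ F`, and the sets `U_{k,n}` form a
neighborhood basis of `k ∈ ℕ`. -/
instance instTopVD (F : Set (ℕ → ℕ)) : TopologicalSpace (VDSpace F) :=
  TopologicalSpace.generateFrom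
    ({V | ∃ p : ↥F × ℕ × ℕ, V = {pt p}} ∪
     {V | ∃ (f : ↥F) (s : Finset (ℕ × ℕ)), V = basicO f s} ∪
     {V | ∃ k n : ℕ, V = (basicU k n : Set (VDSpace F))})

end VDSpace

/-- `f ≤* g`: eventual domination, i.e. `f n ≤ g n` for all but finitely many `n`. -/
def EvLE (f g : ℕ → ℕ) : Prop := ∀ᶠ n in Filter.atTop, f n ≤ g n

open Filter Topology Set

/-- A space carrying a sequence of locally constant maps whose fibers separate points and contain
a neighborhood basis at every point is metrizable. -/
theorem metrizableSpace_of_locallyConstant_seq {X D : Type*} [TopologicalSpace X]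
    (c : ℕ → X → D) (hc : ∀ n, IsLocallyConstant (c n))
    (hinj : ∀ x y, (∀ n, c n x = c n y) → x = y)
    (hbasis : ∀ x, ∀ U ∈ 𝓝 x, ∃ n, c n ⁻¹' {c n x} ⊆ U) :
    TopologicalSpace.MetrizableSpace X := by
  let _ : TopologicalSpace D := ⊥
  have : DiscreteTopology D := ⟨rfl⟩
  have hcont : Continuous fun x n => c n x := continuous_pi fun n => (hc n).continuous
  refine IsEmbedding.metrizableSpace (f := fun x n => c n x) ⟨?_, fun x y h => hinj x y (congrFun h)⟩
  refine isInducing_iff_nhds.2 fun x => le_antisymm (map_le_iff_le_comap.1 hcont.continuousAt) ?_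
  intro U hU
  obtain ⟨n, hn⟩ := hbasis x U hU
  exact ⟨_, ((isOpen_discrete {c n x}).preimage (continuous_apply n)).mem_nhds (mem_singleton _),
    hn⟩

namespace VDSpace

variable {F : Set (ℕ → ℕ)}

theorem cases_points {P : VDSpace F → Prop} (hpt : ∀ f m n, P (pt (f, m, n)))
    (hfn : ∀ f, P (fn f)) (hnat : ∀ k, P (nat k)) (x : VDSpace F) : P x := by
  rcases x with (f | k) | ⟨f, m, n⟩
  exacts [hfn f, hnat k, hpt f m n]

theorem pt_injective : Function.Injective (pt : ↥F × ℕ × ℕ → VDSpace F) := Sum.inr_injective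

theorem fn_injective : Function.Injective (fn : ↥F → VDSpace F) :=
  Sum.inl_injective.comp Sum.inl_injective

theorem nat_injective : Function.Injective (nat : ℕ → VDSpace F) :=
  Sum.inl_injective.comp Sum.inr_injective

@[simp] theorem pt_inj {p q : ↥F × ℕ × ℕ} : pt p = pt q ↔ p = q := pt_injective.eq_iff
@[simp] theorem fn_inj {f g : ↥F} : fn f = fn g ↔ f = g := fn_injective.eq_iff
@[simp] theorem nat_inj {k l : ℕ} : (nat k : VDSpace F) = nat l ↔ k = l := nat_injective.eq_iff
@[simp] theorem fn_ne_pt {f : ↥F} {p : ↥F × ℕ × ℕ} : fn f ≠ pt p := nofun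
@[simp] theorem pt_ne_fn {f : ↥F} {p : ↥F × ℕ × ℕ} : pt p ≠ fn f := nofun
@[simp] theorem nat_ne_pt {k : ℕ} {p : ↥F × ℕ × ℕ} : nat k ≠ pt p := nofun
@[simp] theorem pt_ne_nat {k : ℕ} {p : ↥F × ℕ × ℕ} : pt p ≠ nat k := nofun
@[simp] theorem fn_ne_nat {f : ↥F} {k : ℕ} : fn f ≠ nat k := nofun
@[simp] theorem nat_ne_fn {f : ↥F} {k : ℕ} : nat k ≠ fn f := nofun

@[simp] theorem fn_mem_basicO {f g : ↥F} {s : Finset (ℕ × ℕ)} : fn g ∈ basicO f s ↔ g = f := by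
  simp [basicO]

@[simp] theorem nat_notMem_basicO {f : ↥F} {s : Finset (ℕ × ℕ)} {k : ℕ} :
    nat k ∉ basicO f s := by
  simp [basicO]

@[simp] theorem pt_mem_basicO {f g : ↥F} {s : Finset (ℕ × ℕ)} {m n : ℕ} :
    pt (g, m, n) ∈ basicO f s ↔ g = f ∧ (f : ℕ → ℕ) m = n ∧ (m, n) ∉ s := by
  simp only [basicO, singleton_union, mem_insert_iff, pt_ne_fn, mem_ofPred_eq, false_or, pt_inj,
    Prod.mk.injEq]
  constructor
  · rintro ⟨m, n, h, hs, rfl, rfl, rfl⟩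
    exact ⟨rfl, h, hs⟩
  · rintro ⟨rfl, h, hs⟩
    exact ⟨m, n, h, hs, rfl, rfl, rfl⟩

@[simp] theorem nat_mem_basicU {k l n : ℕ} : (nat l : VDSpace F) ∈ basicU k n ↔ l = k := by
  simp [basicU]

@[simp] theorem fn_notMem_basicU {f : ↥F} {k n : ℕ} : fn f ∉ basicU k n := by
  simp [basicU]

@[simp] theorem pt_mem_basicU {g : ↥F} {k n m l : ℕ} :
    pt (g, m, l) ∈ basicU k n ↔ m = k ∧ n ≤ l := by
  simp only [basicU, singleton_union, mem_insert_iff, pt_ne_nat, mem_ofPred_eq, false_or, pt_inj,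
    Prod.mk.injEq]
  constructor
  · rintro ⟨g, l, h, rfl, rfl, rfl⟩
    exact ⟨rfl, h⟩
  · rintro ⟨rfl, h⟩
    exact ⟨g, l, h, rfl, rfl, rfl⟩

theorem isOpen_singleton_pt (p : ↥F × ℕ × ℕ) : IsOpen {(pt p : VDSpace F)} :=
  .basic _ (.inl (.inl ⟨p, rfl⟩))

theorem isOpen_basicO (f : ↥F) (s : Finset (ℕ × ℕ)) : IsOpen (basicO f s) :=
  .basic _ (.inl (.inr ⟨f, s, rfl⟩))

theorem isOpen_basicU (k n : ℕ) : IsOpen (basicU k n : Set (VDSpace F)) :=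
  .basic _ (.inr ⟨k, n, rfl⟩)

theorem exists_basic_subset_of_isOpen {V : Set (VDSpace F)} (hV : IsOpen V) :
    (∀ f, fn f ∈ V → ∃ s, basicO f s ⊆ V) ∧ ∀ k, nat k ∈ V → ∃ n, basicU k n ⊆ V := by
  induction hV with
  | basic V hV =>
    rcases hV with (⟨p, rfl⟩ | ⟨f, s, rfl⟩) | ⟨k, n, rfl⟩
    · simp
    · refine ⟨fun g hg => ?_, by simp⟩
      obtain rfl := fn_mem_basicO.1 hg
      exact ⟨s, Subset.rfl⟩
    · refine ⟨by simp, fun l hl => ?_⟩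
      obtain rfl := nat_mem_basicU.1 hl
      exact ⟨n, Subset.rfl⟩
  | univ => simp
  | inter V W _ _ hV hW =>
    constructor
    · rintro f ⟨hfV, hfW⟩
      obtain ⟨s, hs⟩ := hV.1 f hfV
      obtain ⟨t, ht⟩ := hW.1 f hfW
      classical
      refine ⟨s ∪ t, subset_inter (Subset.trans ?_ hs) (Subset.trans ?_ ht)⟩ <;>
      · intro x
        induction x using cases_points <;> simp +contextual
    · rintro k ⟨hkV, hkW⟩
      obtain ⟨m, hm⟩ := hV.2 k hkV
      obtain ⟨n, hn⟩ := hW.2 k hkW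
      refine ⟨max m n, subset_inter (Subset.trans ?_ hm) (Subset.trans ?_ hn)⟩ <;>
      · intro x
        induction x using cases_points <;> simp +contextual
  | sUnion S _ ih =>
    constructor
    · rintro f ⟨V, hV, hf⟩
      obtain ⟨s, hs⟩ := (ih V hV).1 f hf
      exact ⟨s, hs.trans (subset_sUnion_of_mem hV)⟩
    · rintro k ⟨V, hV, hk⟩
      obtain ⟨n, hn⟩ := (ih V hV).2 k hk
      exact ⟨n, hn.trans (subset_sUnion_of_mem hV)⟩

theorem nhds_pt (p : ↥F × ℕ × ℕ) : 𝓝 (pt p : VDSpace F) = pure (pt p) :=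
  (isOpen_singleton_iff_nhds_eq_pure _).1 (isOpen_singleton_pt p)

theorem nhds_fn_hasBasis (f : ↥F) : (𝓝 (fn f)).HasBasis (fun _ => True) (basicO f) := by
  refine ⟨fun V => ⟨fun h => ?_, ?_⟩⟩
  · obtain ⟨W, hWV, hW, hf⟩ := mem_nhds_iff.1 h
    obtain ⟨s, hs⟩ := (exists_basic_subset_of_isOpen hW).1 f hf
    exact ⟨s, trivial, hs.trans hWV⟩
  · rintro ⟨s, -, hs⟩
    exact mem_of_superset ((isOpen_basicO f s).mem_nhds (by simp)) hs

theorem nhds_nat_hasBasis (k : ℕ) :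
    (𝓝 (nat k : VDSpace F)).HasBasis (fun _ => True) (basicU k) := by
  refine ⟨fun V => ⟨fun h => ?_, ?_⟩⟩
  · obtain ⟨W, hWV, hW, hk⟩ := mem_nhds_iff.1 h
    obtain ⟨n, hn⟩ := (exists_basic_subset_of_isOpen hW).2 k hk
    exact ⟨n, trivial, hn.trans hWV⟩
  · rintro ⟨n, -, hn⟩
    exact mem_of_superset ((isOpen_basicU k n).mem_nhds (by simp)) hn

instance firstCountableTopology : FirstCountableTopology (VDSpace F) where
  nhds_generated_countable x := by
    induction x using cases_points with
    | hpt f m n => rw [nhds_pt]; infer_instance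
    | hfn f => exact (nhds_fn_hasBasis f).isCountablyGenerated
    | hnat k => exact (nhds_nat_hasBasis k).isCountablyGenerated

theorem isClosed_range_fn : IsClosed (range (fn : ↥F → VDSpace F)) := by
  refine ⟨isOpen_iff_mem_nhds.2 fun x hx => ?_⟩
  induction x using cases_points with
  | hpt f m n => simp [nhds_pt]
  | hfn f => simp at hx
  | hnat k =>
    refine mem_of_superset ((nhds_nat_hasBasis k).mem_of_mem (i := 0) trivial) fun y => ?_
    induction y using cases_points <;> simp

theorem isClosed_range_nat : IsClosed (range (nat : ℕ → VDSpace F)) := by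
  refine ⟨isOpen_iff_mem_nhds.2 fun x hx => ?_⟩
  induction x using cases_points with
  | hpt f m n => simp [nhds_pt]
  | hfn f =>
    refine mem_of_superset ((nhds_fn_hasBasis f).mem_of_mem (i := ∅) trivial) fun y => ?_
    induction y using cases_points <;> simp
  | hnat k => simp at hx

theorem eventually_mem_of_mem_nhds_fn {f : ↥F} {V : Set (VDSpace F)} (hV : V ∈ 𝓝 (fn f)) :
    ∀ᶠ m in atTop, pt (f, m, (f : ℕ → ℕ) m) ∈ V := by
  obtain ⟨s, -, hs⟩ := (nhds_fn_hasBasis f).mem_iff.1 hV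
  have hfin : {m | (m, (f : ℕ → ℕ) m) ∈ s}.Finite :=
    s.finite_toSet.preimage (f := fun m => (m, (f : ℕ → ℕ) m))
      fun a _ b _ h => congrArg Prod.fst h
  rw [← Nat.cofinite_eq_atTop]
  filter_upwards [hfin.eventually_cofinite_notMem] with m hm
  exact hs (pt_mem_basicO.2 ⟨rfl, rfl, hm⟩)

/-- Separating the closed sets `F` and `ℕ` yields a bound for `F`. -/
theorem exists_bound_of_normalSpace [NormalSpace (VDSpace F)] :
    ∃ g : ℕ → ℕ, ∀ f ∈ F, EvLE f g := by
  have hdisj : Disjoint (range (fn : ↥F → VDSpace F)) (range nat) := by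
    rw [disjoint_left]
    rintro _ ⟨f, rfl⟩ ⟨k, hk⟩
    simp at hk
  obtain ⟨U, V, hU, hV, hFU, hNV, hUV⟩ :=
    NormalSpace.normal _ _ isClosed_range_fn isClosed_range_nat hdisj
  choose g hg using fun k => (exists_basic_subset_of_isOpen hV).2 k (hNV ⟨k, rfl⟩)
  refine ⟨g, fun f hf => ?_⟩
  filter_upwards [eventually_mem_of_mem_nhds_fn (hU.mem_nhds (hFU ⟨⟨f, hf⟩, rfl⟩))] with m hm
  by_contra! hlt
  exact disjoint_left.1 hUV hm (hg m (pt_mem_basicU.2 ⟨rfl, hlt.le⟩))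

open Classical in
/-- The retraction collapsing the `n`-th neighborhoods of the points of `ℕ` and `F` (chosen
pairwise disjoint with the help of `g`) and fixing all other points. -/
noncomputable def collapse (g : ℕ → ℕ) (n : ℕ) : VDSpace F → VDSpace F
  | .inl x => .inl x
  | .inr (f, m, l) =>
    if max (g m + 1) n ≤ l then nat m
    else if (f : ℕ → ℕ) m = l ∧ n ≤ m then fn f else pt (f, m, l)

@[simp] theorem collapse_fn (g : ℕ → ℕ) (n : ℕ) (f : ↥F) : collapse g n (fn f) = fn f := rfl

@[simp] theorem collapse_nat (g : ℕ → ℕ) (n k : ℕ) :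
    collapse g n (nat k : VDSpace F) = nat k := rfl

open Classical in
theorem collapse_pt (g : ℕ → ℕ) (n : ℕ) (f : ↥F) (m l : ℕ) :
    collapse g n (pt (f, m, l)) = if max (g m + 1) n ≤ l then nat m
      else if (f : ℕ → ℕ) m = l ∧ n ≤ m then fn f else pt (f, m, l) := rfl

theorem eventually_collapse_eq_nat (g : ℕ → ℕ) (n k : ℕ) :
    ∀ᶠ y in 𝓝 (nat k : VDSpace F), collapse g n y = nat k := by
  refine mem_of_superset
    ((nhds_nat_hasBasis k).mem_of_mem (i := max (g k + 1) n) trivial) fun y hy => ?_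
  induction y using cases_points with
  | hpt f m l =>
    obtain ⟨rfl, h⟩ := pt_mem_basicU.1 hy
    exact if_pos h
  | hfn f => simp at hy
  | hnat l => simpa using hy

theorem eventually_collapse_eq_fn {g : ℕ → ℕ} (n : ℕ) {f : ↥F} (hf : EvLE f g) :
    ∀ᶠ y in 𝓝 (fn f), collapse g n y = fn f := by
  obtain ⟨N, hN⟩ := eventually_atTop.1 hf
  refine mem_of_superset ((nhds_fn_hasBasis f).mem_of_mem
    (i := (Finset.range (max N n)).image fun m => (m, (f : ℕ → ℕ) m)) trivial) fun y hy => ?_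
  induction y using cases_points with
  | hpt f' m l =>
    obtain ⟨rfl, rfl, h⟩ := pt_mem_basicO.1 hy
    have hm : max N n ≤ m := by simpa using h
    have hle := hN m (le_of_max_le_left hm)
    change collapse g n _ = _
    rw [collapse_pt, if_neg (by omega), if_pos ⟨rfl, le_of_max_le_right hm⟩]
  | hfn f' => simpa using hy
  | hnat l => simp at hy

theorem exists_collapse_preimage_subset (g : ℕ → ℕ) (x : VDSpace F) {U : Set (VDSpace F)}
    (hU : U ∈ 𝓝 x) : ∃ n, collapse g n ⁻¹' {collapse g n x} ⊆ U := by
  induction x using cases_points with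
  | hpt f m l =>
    have hx : collapse g (max m l + 1) (pt (f, m, l)) = pt (f, m, l) := by
      rw [collapse_pt, if_neg (by omega), if_neg (by omega)]
    refine ⟨max m l + 1, fun y hy => ?_⟩
    suffices y = pt (f, m, l) from this ▸ mem_of_mem_nhds hU
    rw [mem_preimage, hx, mem_singleton_iff] at hy
    induction y using cases_points with
    | hpt f' m' l' =>
      rw [collapse_pt] at hy
      split_ifs at hy
      · simp at hy
      · simp at hy
      · exact hy
    | hfn f' => simp at hy
    | hnat k => simp at hy
  | hfn f =>
    obtain ⟨s, -, hs⟩ := (nhds_fn_hasBasis f).mem_iff.1 hU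
    obtain ⟨N, hN⟩ := (s.image Prod.fst).bddAbove
    refine ⟨N + 1, Subset.trans (fun y hy => ?_) hs⟩
    rw [mem_preimage, collapse_fn, mem_singleton_iff] at hy
    induction y using cases_points with
    | hpt f' m l =>
      rw [collapse_pt] at hy
      split_ifs at hy with h₁ h₂
      · simp at hy
      · obtain rfl := fn_inj.1 hy
        refine pt_mem_basicO.2 ⟨rfl, h₂.1, fun hmem => ?_⟩
        have := hN (Finset.mem_coe.2 (Finset.mem_image_of_mem Prod.fst hmem))
        omega
      · simp at hy
    | hfn f' => simpa using hy
    | hnat k => simp at hy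
  | hnat k =>
    obtain ⟨n, -, hn⟩ := (nhds_nat_hasBasis k).mem_iff.1 hU
    refine ⟨n, Subset.trans (fun y hy => ?_) hn⟩
    rw [mem_preimage, collapse_nat, mem_singleton_iff] at hy
    induction y using cases_points with
    | hpt f' m l =>
      rw [collapse_pt] at hy
      split_ifs at hy with h₁ h₂
      · exact pt_mem_basicU.2 ⟨nat_inj.1 hy, le_of_max_le_right h₁⟩
      · simp at hy
      · simp at hy
    | hfn f' => simp at hy
    | hnat k => simpa using hy

instance t1Space : T1Space (VDSpace F) := by
  refine t1Space_iff_exists_open.2 fun x y hxy => ?_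
  induction x using cases_points with
  | hpt f m l => exact ⟨_, isOpen_singleton_pt _, rfl, hxy.symm⟩
  | hfn f =>
    induction y using cases_points with
    | hpt f' m l => exact ⟨_, isOpen_basicO f {(m, l)}, by simp, by simp⟩
    | hfn f' => exact ⟨_, isOpen_basicO f ∅, by simp, by simpa using hxy.symm⟩
    | hnat k => exact ⟨_, isOpen_basicO f ∅, by simp, by simp⟩
  | hnat k =>
    induction y using cases_points with
    | hpt f' m l => exact ⟨_, isOpen_basicU k (l + 1), by simp, by simp⟩
    | hfn f' => exact ⟨_, isOpen_basicU k 0, by simp, by simp⟩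
    | hnat k' => exact ⟨_, isOpen_basicU k 0, by simp, by simpa using hxy.symm⟩

theorem metrizableSpace_subtype {Y : Set (VDSpace F)} {g : ℕ → ℕ}
    (hg : ∀ f : ↥F, fn f ∈ Y → EvLE f g) : TopologicalSpace.MetrizableSpace Y := by
  have hbasis (x : Y) (U) (hU : U ∈ 𝓝 x) :
      ∃ n, (fun y : Y => collapse g n y) ⁻¹' {collapse g n x.1} ⊆ U := by
    obtain ⟨V, hV, hVU⟩ := mem_nhds_subtype Y x U |>.1 hU
    obtain ⟨n, hn⟩ := exists_collapse_preimage_subset g _ hV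
    exact ⟨n, fun y hy => hVU (hn hy)⟩
  refine metrizableSpace_of_locallyConstant_seq (fun n (y : Y) => collapse g n y.1) (fun n => ?_)
    (fun x y hxy => ?_) hbasis
  · refine (IsLocallyConstant.iff_eventually_eq _).2 fun ⟨x, hx⟩ => ?_
    refine continuousAt_subtype_val.eventually (p := fun y => collapse g n y = collapse g n x) ?_
    change ∀ᶠ y in 𝓝 x, _
    induction x using cases_points with
    | hpt f m l => simp [nhds_pt]
    | hfn f => exact eventually_collapse_eq_fn n (hg f hx)
    | hnat k => exact eventually_collapse_eq_nat g n k
  · by_contra hne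
    obtain ⟨n, hn⟩ := hbasis x _ (isOpen_ne.mem_nhds hne)
    exact hn (a := y) (hxy n).symm rfl

theorem mk_eq_of_infinite [Infinite F] : Cardinal.mk (VDSpace F) = Cardinal.mk F := by
  have h := Cardinal.aleph0_le_mk ↥F
  change Cardinal.mk ((↥F ⊕ ℕ) ⊕ (↥F × ℕ × ℕ)) = _
  simp [Cardinal.mul_aleph0_eq h, Cardinal.add_eq_left h h, Cardinal.add_eq_left h le_rfl]

end VDSpace

/-- If `F ⊆ ℕ → ℕ` is unbounded with respect to `≤*` but every subfamily of strictly smaller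
cardinality is bounded, then the van Douwen space `X_F` is a first countable non-metrizable
space of the same cardinality as `F` all of whose subspaces of cardinality `< |F|` are
metrizable. -/
theorem vanDouwen_reflection (F : Set (ℕ → ℕ))
    (hunb : ¬ ∃ g : ℕ → ℕ, ∀ f ∈ F, EvLE f g)
    (hsmall : ∀ F₀ : Set (ℕ → ℕ), F₀ ⊆ F → Cardinal.mk F₀ < Cardinal.mk F →
      ∃ g : ℕ → ℕ, ∀ f ∈ F₀, EvLE f g) :
    FirstCountableTopology (VDSpace F) ∧
    Cardinal.mk (VDSpace F) = Cardinal.mk F ∧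
    ¬ TopologicalSpace.MetrizableSpace (VDSpace F) ∧
    ∀ Y : Set (VDSpace F), Cardinal.mk Y < Cardinal.mk F →
      TopologicalSpace.MetrizableSpace Y := by
  have hinf : Infinite F := by
    refine infinite_coe_iff.2 fun hfin => hunb ?_
    obtain ⟨g, hg⟩ := hfin.bddAbove
    exact ⟨g, fun f hf => .of_forall (hg hf)⟩
  refine ⟨inferInstance, VDSpace.mk_eq_of_infinite,
    fun _ => hunb VDSpace.exists_bound_of_normalSpace, fun Y hY => ?_⟩
  obtain ⟨g, hg⟩ := hsmall ((↑) '' {f : ↥F | VDSpace.fn f ∈ Y}) (by simp) <|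
    (Cardinal.mk_image_le.trans (Cardinal.mk_preimage_of_injective _ Y
      VDSpace.fn_injective)).trans_lt hY
  exact VDSpace.metrizableSpace_subtype fun f hf => hg f ⟨f, hf, rfl⟩
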